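/- Let F = ⟨f_1,…,f_r⟩ be a shortest valid sequence of flips transforming a triangulation T_start of P into a triangulation T_end of P, and let π = ⟨g_1,…,g_r⟩ be any permutation of F that is a topological sorting of D_F. Then for every j with 0 ≤ j < r, the triangulation obtained from T_start by performing the first j flips g_1,…,g_j is different from T_end. -/

import Mathlib

noncomputable section

/-- Points of the Euclidean plane. -/
abbrev Pt : Type := EuclideanSpace ℝ (Fin 2)

/-- The closed segment spanned by an unordered pair of points. -/
def segOf : Sym2 Pt → Set Pt :=
  Sym2.lift ⟨fun p q => segment ℝ p q, fun _ _ => segment_symm ℝ _ _⟩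

/-- The open segment (relative interior) spanned by an unordered pair of points. -/
def openSegOf : Sym2 Pt → Set Pt :=
  Sym2.lift ⟨fun p q => openSegment ℝ p q, fun _ _ => openSegment_symm ℝ _ _⟩

/-- A set of closed line segments (given by unordered pairs of distinct endpoints in `P`)
that pairwise intersect only in common endpoints and whose relative interiors contain
no point of `P`. -/
def ValidEdgeSet (P : Set Pt) (T : Set (Sym2 Pt)) : Prop :=
  (∀ e ∈ T, ¬ e.IsDiag) ∧
  (∀ e ∈ T, ∀ x ∈ e, x ∈ P) ∧
  (∀ e ∈ T, ∀ f ∈ T, e ≠ f → ∀ x, x ∈ segOf e → x ∈ segOf f → x ∈ e ∧ x ∈ f) ∧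
  (∀ e ∈ T, ∀ p ∈ P, p ∉ openSegOf e)

/-- A triangulation of `P`: a maximal valid edge set. -/
def IsTriangulation (P : Set Pt) (T : Set (Sym2 Pt)) : Prop :=
  ValidEdgeSet P T ∧ ∀ T', ValidEdgeSet P T' → T ⊆ T' → T' = T

/-- `a`, `b`, `c` span a triangle of the triangulation `T` of `P`. -/
def IsTriangleOf (P : Set Pt) (T : Set (Sym2 Pt)) (a b c : Pt) : Prop :=
  s(a, b) ∈ T ∧ s(b, c) ∈ T ∧ s(a, c) ∈ T ∧
  ¬ Collinear ℝ ({a, b, c} : Set Pt) ∧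
  ∀ p ∈ P, p ∈ convexHull ℝ ({a, b, c} : Set Pt) → p = a ∨ p = b ∨ p = c

/-- `e` is an edge of the triangle on `a`, `b`, `c`. -/
def EdgeOfTriangle (e : Sym2 Pt) (a b c : Pt) : Prop :=
  e = s(a, b) ∨ e = s(b, c) ∨ e = s(a, c)

/-- Two edges share a triangle of the triangulation `T`. -/
def ShareTriangle (P : Set Pt) (T : Set (Sym2 Pt)) (e f : Sym2 Pt) : Prop :=
  ∃ a b c, IsTriangleOf P T a b c ∧ EdgeOfTriangle e a b c ∧ EdgeOfTriangle f a b c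

/-- A set of points is in convex position. -/
def ConvexPosition (s : Set Pt) : Prop :=
  ∀ x ∈ s, x ∉ convexHull ℝ (s \ {x})

/-- A flip is recorded by its underlying edge `ε(f)` (first component) and its
resulting edge `φ(f)` (second component). -/
abbrev FlipData : Type := Sym2 Pt × Sym2 Pt

/-- The two triangles `abc` and `acd` of `T` incident to the edge `s(a,c)` form a
convex quadrilateral with diagonal `s(a,c)` (the other diagonal being `s(b,d)`). -/
def IsFlipQuad (P : Set Pt) (T : Set (Sym2 Pt)) (a b c d : Pt) : Prop :=
  IsTriangleOf P T a b c ∧ IsTriangleOf P T a c d ∧ b ≠ d ∧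
  ConvexPosition ({a, b, c, d} : Set Pt)

/-- The flip `f` is applicable in the triangulation `T` and transforms `T` into `T'`. -/
def FlipsTo (P : Set Pt) (T T' : Set (Sym2 Pt)) (f : FlipData) : Prop :=
  IsTriangulation P T ∧ f.1 ∈ T ∧
  ∃ a b c d, IsFlipQuad P T a b c d ∧ f.1 = s(a, c) ∧ f.2 = s(b, d) ∧
    T' = (T \ {f.1}) ∪ {f.2}

/-- `F` is a valid sequence of flips transforming `T` into `T'`. -/
def ValidSeq (P : Set Pt) : Set (Sym2 Pt) → List FlipData → Set (Sym2 Pt) → Prop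
  | T, [], T' => T = T'
  | T, f :: fs, T' => ∃ T₁, FlipsTo P T T₁ f ∧ ValidSeq P T₁ fs T'

/-- The flip distance between `T` and `T'` equals `k`. -/
def IsFlipDist (P : Set Pt) (T T' : Set (Sym2 Pt)) (k : ℕ) : Prop :=
  (∃ F : List FlipData, ValidSeq P T F T' ∧ F.length = k) ∧
  ∀ F : List FlipData, ValidSeq P T F T' → k ≤ F.length

/-- Apply a list of flips (as set operations) to a triangulation. -/
def applyFlips : Set (Sym2 Pt) → List FlipData → Set (Sym2 Pt)
  | T, [] => T
  | T, f :: fs => applyFlips ((T \ {f.1}) ∪ {f.2}) fs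

/-- The arc relation of the DAG `D_F` (on 0-based positions of the flips in `F`),
for a valid sequence `F` starting at `T₀`. -/
def Arc (P : Set Pt) (T₀ : Set (Sym2 Pt)) (F : List FlipData) (i j : ℕ) : Prop :=
  ∃ (hi : i < F.length) (hj : j < F.length), i < j ∧
    ((F.get ⟨i, hi⟩).2 = (F.get ⟨j, hj⟩).1 ∨
      ShareTriangle P (applyFlips T₀ (F.take j)) (F.get ⟨i, hi⟩).2 (F.get ⟨j, hj⟩).1) ∧
    ∀ p, ∀ hp : p < F.length, i < p → p < j → (F.get ⟨p, hp⟩).1 ≠ (F.get ⟨i, hi⟩).2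

/-- `F'` is a permutation of `F` that is a topological sorting of `D_F`. -/
def IsTopologicalSorting (P : Set Pt) (T₀ : Set (Sym2 Pt)) (F F' : List FlipData) : Prop :=
  ∃ (hlen : F'.length = F.length) (σ : Fin F.length ≃ Fin F.length),
    (∀ m : Fin F.length, F'.get (Fin.cast hlen.symm m) = F.get (σ m)) ∧
    ∀ m n : Fin F.length, Arc P T₀ F (σ m) (σ n) → m < n

/-- Twice the signed area of the triangle `a b c`. -/
def signedArea (a b c : Pt) : ℝ :=
  (b 0 - a 0) * (c 1 - a 1) - (b 1 - a 1) * (c 0 - a 0)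

theorem signedArea_rotate (a b c : Pt) : signedArea b c a = signedArea a b c := by
  unfold signedArea; ring

theorem signedArea_swap (a b c : Pt) : signedArea a c b = -signedArea a b c := by
  unfold signedArea; ring

theorem signedArea_self_left (a b : Pt) : signedArea a b a = 0 := by
  unfold signedArea; ring

theorem signedArea_self_right (a b : Pt) : signedArea a b b = 0 := by
  unfold signedArea; ring

theorem signedArea_self (a b : Pt) : signedArea a a b = 0 := by
  unfold signedArea; ring

theorem signedArea_add (a b c d : Pt) :
    signedArea a b d + signedArea b c d + signedArea c a d = signedArea a b c := by
  unfold signedArea; ring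

theorem signedArea_combo (a b x y : Pt) {s t : ℝ} (h : s + t = 1) :
    signedArea a b (s • x + t • y) = s * signedArea a b x + t * signedArea a b y := by
  obtain rfl : s = 1 - t := by linarith
  simp only [signedArea, PiLp.add_apply, PiLp.smul_apply, smul_eq_mul]
  ring

theorem collinear_iff_signedArea (a b c : Pt) :
    Collinear ℝ ({a, b, c} : Set Pt) ↔ signedArea a b c = 0 := by
  constructor
  · intro h
    obtain ⟨v, hv⟩ := (collinear_iff_of_mem (p₀ := a) (by simp)).1 h
    obtain ⟨r, rfl⟩ := hv b (by simp)
    obtain ⟨s, rfl⟩ := hv c (by simp)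
    simp only [signedArea, vadd_eq_add, PiLp.add_apply, PiLp.smul_apply, smul_eq_mul]
    ring
  · intro h
    by_cases hab : a = b
    · subst hab
      simpa using collinear_pair ℝ a c
    · refine (collinear_iff_of_mem (p₀ := a) (by simp)).2 ⟨b - a, ?_⟩
      have key : ∃ r : ℝ, c = r • (b - a) +ᵥ a := by
        unfold signedArea at h
        by_cases h0 : b 0 - a 0 = 0
        · have h1 : b 1 - a 1 ≠ 0 := by
            intro h1
            apply hab
            ext i
            fin_cases i
            · simp only [Fin.zero_eta]; linarith
            · simp only [Fin.mk_one]; linarith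
          refine ⟨(c 1 - a 1) / (b 1 - a 1), ?_⟩
          rw [h0] at h
          have h2 : c 0 - a 0 = 0 := by
            have : (b 1 - a 1) * (c 0 - a 0) = 0 := by linarith
            exact (mul_eq_zero.1 this).resolve_left h1
          ext i
          fin_cases i
          · simp [h0]; linarith
          · simp; field_simp; ring
        · refine ⟨(c 0 - a 0) / (b 0 - a 0), ?_⟩
          ext i
          fin_cases i
          · simp; field_simp; ring
          · simp; field_simp; linarith
      rintro p (rfl | rfl | rfl)
      · exact ⟨0, by simp⟩
      · exact ⟨1, by simp⟩
      · exact key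

theorem signedArea_nonneg_of_mem_convexHull {u v p : Pt} {s : Set Pt}
    (hs : ∀ x ∈ s, 0 ≤ signedArea u v x) (hp : p ∈ convexHull ℝ s) : 0 ≤ signedArea u v p := by
  have hc : Convex ℝ {x | 0 ≤ signedArea u v x} := by
    intro x hx y hy α β hα hβ h
    simp only [Set.mem_ofPred_eq] at *
    rw [signedArea_combo _ _ _ _ h]
    positivity
  exact convexHull_min hs hc hp

theorem mem_convexHull_of_signedArea_nonneg {a b c p : Pt} (h : 0 < signedArea a b c)
    (h₁ : 0 ≤ signedArea a b p) (h₂ : 0 ≤ signedArea b c p) (h₃ : 0 ≤ signedArea c a p) :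
    p ∈ convexHull ℝ ({a, b, c} : Set Pt) := by
  have hp : p = ∑ i : Fin 3, (![signedArea b c p / signedArea a b c,
      signedArea c a p / signedArea a b c, signedArea a b p / signedArea a b c] i) •
      (![a, b, c] i) := by
    simp only [Fin.sum_univ_three, Matrix.cons_val]
    have hne := h.ne'
    ext i
    simp only [PiLp.add_apply, PiLp.smul_apply, smul_eq_mul]
    field_simp
    fin_cases i <;> simp [signedArea] <;> ring
  rw [hp]
  refine (convex_convexHull ℝ _).sum_mem ?_ ?_ ?_
  · intro i _
    fin_cases i <;> simp <;> positivity
  · simp only [Fin.sum_univ_three, Matrix.cons_val]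
    have := signedArea_add a b c p
    field_simp
    linarith
  · intro i _
    apply subset_convexHull
    fin_cases i <;> simp

theorem exists_mem_segment_of_signedArea {p q r s : Pt}
    (h₁ : signedArea p q r < 0) (h₂ : 0 < signedArea p q s)
    (h₃ : 0 < signedArea r s p) (h₄ : signedArea r s q < 0) :
    ∃ x, x ∈ segment ℝ p q ∧ x ∈ segment ℝ r s := by
  have hd : 0 < signedArea p q s - signedArea p q r := by linarith
  have he : signedArea r s p - signedArea r s q = signedArea p q s - signedArea p q r := by
    unfold signedArea; ring
  refine ⟨(signedArea p q s / (signedArea p q s - signedArea p q r)) • r +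
    (-signedArea p q r / (signedArea p q s - signedArea p q r)) • s,
    ⟨-signedArea r s q / (signedArea p q s - signedArea p q r),
      signedArea r s p / (signedArea p q s - signedArea p q r), ?_, ?_, ?_, ?_⟩,
    ⟨_, _, ?_, ?_, ?_, rfl⟩⟩
  · exact div_nonneg (by linarith) hd.le
  · exact div_nonneg (by linarith) hd.le
  · field_simp; linarith
  · have hne := hd.ne'
    ext i
    simp only [PiLp.add_apply, PiLp.smul_apply, smul_eq_mul]
    field_simp
    fin_cases i <;> simp [signedArea] <;> ring
  · exact div_nonneg (by linarith) hd.le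
  · exact div_nonneg (by linarith) hd.le
  · field_simp; linarith

theorem ValidEdgeSet.not_crossing {P : Set Pt} {T : Set (Sym2 Pt)} (hT : ValidEdgeSet P T)
    {p q r s : Pt} (hpq : s(p, q) ∈ T) (hrs : s(r, s) ∈ T)
    (h₁ : signedArea p q r < 0) (h₂ : 0 < signedArea p q s)
    (h₃ : 0 < signedArea r s p) (h₄ : signedArea r s q < 0) : False := by
  obtain ⟨x, hx, hx'⟩ := exists_mem_segment_of_signedArea h₁ h₂ h₃ h₄
  have hne : s(p, q) ≠ s(r, s) := by
    intro h
    have hr : r ∈ s(p, q) := h ▸ Sym2.mem_mk_left r s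
    rcases Sym2.mem_iff.1 hr with rfl | rfl
    · simp [signedArea_self_left] at h₁
    · simp [signedArea_self_right] at h₁
  obtain ⟨ha, hb⟩ := hT.2.2.1 _ hpq _ hrs hne x hx hx'
  rcases Sym2.mem_iff.1 ha with rfl | rfl <;> rcases Sym2.mem_iff.1 hb with rfl | rfl <;>
    simp [signedArea_self_left, signedArea_self_right] at *

/-- Two triangles on the same side of a common edge coincide. -/
theorem IsTriangleOf.apex_unique {P : Set Pt} {T : Set (Sym2 Pt)} (hT : ValidEdgeSet P T)
    {a c b d : Pt} (hb : IsTriangleOf P T a c b) (hd : IsTriangleOf P T a c d)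
    (hb' : 0 < signedArea a c b) (hd' : 0 < signedArea a c d) : b = d := by
  obtain ⟨hac, hcb, hab, -, heb⟩ := hb
  obtain ⟨-, hcd, had, -, hed⟩ := hd
  have hbP : b ∈ P := hT.2.1 _ hcb b (Sym2.mem_mk_right _ _)
  have hdP : d ∈ P := hT.2.1 _ hcd d (Sym2.mem_mk_right _ _)
  have e₁ : signedArea c d b = -signedArea c b d := signedArea_swap _ _ _
  have e₂ : signedArea d a b = -signedArea b a d := by unfold signedArea; ring
  have e₃ : signedArea a d c = -signedArea a c d := signedArea_swap _ _ _
  have e₄ : signedArea a d b = signedArea b a d := signedArea_rotate _ _ _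
  have e₅ : signedArea c b a = signedArea a c b := signedArea_rotate _ _ _
  have e₆ : signedArea a b c = -signedArea a c b := signedArea_swap _ _ _
  have e₇ : signedArea c d a = signedArea a c d := signedArea_rotate _ _ _
  have e₈ : signedArea a b d = -signedArea b a d := by unfold signedArea; ring
  have aux₁ : 0 ≤ signedArea c b d → 0 ≤ signedArea b a d → b = d := by
    intro h h'
    rcases heb d hdP (mem_convexHull_of_signedArea_nonneg hb' hd'.le h h') with rfl | rfl | rfl
    · simp [signedArea_self_left] at hd'
    · simp [signedArea_self_right] at hd'
    · rfl
  have aux₂ : 0 ≤ signedArea c d b → 0 ≤ signedArea d a b → b = d := by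
    intro h h'
    rcases hed b hbP (mem_convexHull_of_signedArea_nonneg hd' hb'.le h h') with rfl | rfl | rfl
    · simp [signedArea_self_left] at hb'
    · simp [signedArea_self_right] at hb'
    · rfl
  rcases lt_or_ge (signedArea c b d) 0 with hX | hX <;>
    rcases lt_or_ge (signedArea b a d) 0 with hY | hY
  · exact aux₂ (by linarith) (by linarith)
  · rcases hY.eq_or_lt with hY | hY
    · exact aux₂ (by linarith) (by linarith)
    · exact (hT.not_crossing had hcb (by linarith) (by linarith) (by linarith) (by linarith)).elim
  · rcases hX.eq_or_lt with hX | hX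
    · exact aux₂ (by linarith) (by linarith)
    · exact (hT.not_crossing hab hcd (by linarith) (by linarith) (by linarith) (by linarith)).elim
  · exact aux₁ hX hY

/-- `a`, `b`, `c`, `d` are, in counterclockwise order, the corners of a strictly convex
quadrilateral that contains no other point of `P` and whose sides belong to `T`. -/
structure IsQuad (P : Set Pt) (T : Set (Sym2 Pt)) (a b c d : Pt) : Prop where
  abc : 0 < signedArea a b c
  bcd : 0 < signedArea b c d
  cda : 0 < signedArea c d a
  dab : 0 < signedArea d a b
  ab_mem : s(a, b) ∈ T
  bc_mem : s(b, c) ∈ T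
  cd_mem : s(c, d) ∈ T
  da_mem : s(d, a) ∈ T
  empty : ∀ p ∈ P, 0 ≤ signedArea a b p → 0 ≤ signedArea b c p → 0 ≤ signedArea c d p →
    0 ≤ signedArea d a p → p = a ∨ p = b ∨ p = c ∨ p = d

theorem IsQuad.rotate {P : Set Pt} {T : Set (Sym2 Pt)} {a b c d : Pt} (h : IsQuad P T a b c d) :
    IsQuad P T b c d a where
  abc := h.bcd
  bcd := h.cda
  cda := h.dab
  dab := h.abc
  ab_mem := h.bc_mem
  bc_mem := h.cd_mem
  cd_mem := h.da_mem
  da_mem := h.ab_mem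
  empty p hp h₁ h₂ h₃ h₄ := by
    have := h.empty p hp h₄ h₁ h₂ h₃
    tauto

theorem IsQuad.isTriangleOf {P : Set Pt} {T : Set (Sym2 Pt)} {a b c d : Pt}
    (h : IsQuad P T a b c d) (hac : s(a, c) ∈ T) : IsTriangleOf P T a b c := by
  have h₁ := h.abc
  have h₂ := h.bcd
  have h₃ := h.cda
  have h₄ := h.dab
  have e₁ : signedArea c d b = signedArea b c d := signedArea_rotate _ _ _
  have e₂ : signedArea d a c = signedArea c d a := signedArea_rotate _ _ _
  have e₃ : signedArea b c a = signedArea a b c := signedArea_rotate _ _ _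
  have e₄ : signedArea c a b = signedArea a b c := by unfold signedArea; ring
  have e₅ : signedArea c a d = -signedArea c d a := signedArea_swap _ _ _
  refine ⟨h.ab_mem, h.bc_mem, hac, ?_, ?_⟩
  · rw [collinear_iff_signedArea]
    exact h₁.ne'
  · intro p hp hmem
    have key : ∀ u v : Pt, 0 ≤ signedArea u v a → 0 ≤ signedArea u v b → 0 ≤ signedArea u v c →
        0 ≤ signedArea u v p := by
      intro u v ha hb hc
      refine signedArea_nonneg_of_mem_convexHull ?_ hmem
      rintro x (rfl | rfl | rfl) <;> assumption
    have hca := key c a (by simp [signedArea_self_right]) (by linarith)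
      (by simp [signedArea_self_left])
    rcases h.empty p hp
      (key _ _ (by simp [signedArea_self_left]) (by simp [signedArea_self_right]) h₁.le)
      (key _ _ (by linarith) (by simp [signedArea_self_left]) (by simp [signedArea_self_right]))
      (key _ _ h₃.le (by linarith) (by simp [signedArea_self_left]))
      (key _ _ (by simp [signedArea_self_right]) h₄.le (by linarith)) with rfl | rfl | rfl | rfl
    · simp
    · simp
    · simp
    · linarith

theorem IsTriangleOf.of_perm {P : Set Pt} {T : Set (Sym2 Pt)} {a b c a' b' c' : Pt}
    (h : IsTriangleOf P T a b c) (hs : ({a', b', c'} : Set Pt) = {a, b, c})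
    (h₁ : s(a', b') ∈ T) (h₂ : s(b', c') ∈ T) (h₃ : s(a', c') ∈ T) :
    IsTriangleOf P T a' b' c' := by
  refine ⟨h₁, h₂, h₃, hs ▸ h.2.2.2.1, fun p hp hmem => ?_⟩
  have := h.2.2.2.2 p hp (hs ▸ hmem)
  have h' : p ∈ ({a', b', c'} : Set Pt) := by rw [hs]; simpa using this
  simpa using h'

theorem IsTriangleOf.rotate {P : Set Pt} {T : Set (Sym2 Pt)} {a b c : Pt}
    (h : IsTriangleOf P T a b c) : IsTriangleOf P T b c a :=
  h.of_perm (by ext; simp; tauto) h.2.1 (Sym2.eq_swap ▸ h.2.2.1) (Sym2.eq_swap ▸ h.1)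

theorem IsTriangleOf.swap {P : Set Pt} {T : Set (Sym2 Pt)} {a b c : Pt}
    (h : IsTriangleOf P T a b c) : IsTriangleOf P T b a c :=
  h.of_perm (by ext; simp; tauto) (Sym2.eq_swap ▸ h.1) h.2.2.1 h.2.1

theorem IsTriangleOf.signedArea_ne_zero {P : Set Pt} {T : Set (Sym2 Pt)} {a b c : Pt}
    (h : IsTriangleOf P T a b c) : signedArea a b c ≠ 0 :=
  fun h0 => h.2.2.2.1 ((collinear_iff_signedArea _ _ _).2 h0)

theorem IsQuad.convexPosition {P : Set Pt} {T : Set (Sym2 Pt)} {a b c d : Pt}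
    (h : IsQuad P T a b c d) : ConvexPosition ({a, b, c, d} : Set Pt) := by
  have key : ∀ {a b c d : Pt}, IsQuad P T a b c d →
      a ∉ convexHull ℝ (({a, b, c, d} : Set Pt) \ {a}) := by
    intro a b c d h hmem
    have h₁ := h.abc
    have h₄ := h.dab
    have e₁ : signedArea d b a = -signedArea d a b := signedArea_swap _ _ _
    have e₂ : signedArea d b c = signedArea b c d := by unfold signedArea; ring
    have := signedArea_nonneg_of_mem_convexHull (u := d) (v := b) (p := a) ?_ hmem
    · linarith
    · rintro x ⟨rfl | rfl | rfl | rfl, hx⟩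
      · exact absurd rfl hx
      · simp [signedArea_self_right]
      · rw [e₂]; exact h.bcd.le
      · simp [signedArea_self_left]
  have r : ∀ a b c d : Pt, ({a, b, c, d} : Set Pt) = {b, c, d, a} := by
    intro a b c d; ext; simp; tauto
  rintro x (rfl | rfl | rfl | rfl)
  · exact key h
  · rw [r]; exact key h.rotate
  · rw [r, r]; exact key h.rotate.rotate
  · rw [r, r, r]; exact key h.rotate.rotate.rotate

theorem IsQuad.not_mem_diagonal {P : Set Pt} {T : Set (Sym2 Pt)} {a b c d : Pt}
    (hT : ValidEdgeSet P T) (h : IsQuad P T a b c d) (hac : s(a, c) ∈ T) : s(b, d) ∉ T := by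
  intro hbd
  have h₁ := h.abc
  have h₂ := h.bcd
  have h₃ := h.cda
  have h₄ := h.dab
  have e₁ : signedArea a c b = -signedArea a b c := signedArea_swap _ _ _
  have e₂ : signedArea a c d = signedArea c d a := by unfold signedArea; ring
  have e₃ : signedArea b d a = signedArea d a b := by unfold signedArea; ring
  have e₄ : signedArea b d c = -signedArea b c d := signedArea_swap _ _ _
  exact hT.not_crossing hac hbd (by linarith) (by linarith) (by linarith) (by linarith)

theorem IsQuad.isFlipQuad {P : Set Pt} {T : Set (Sym2 Pt)} {a b c d : Pt}
    (h : IsQuad P T a b c d) (hac : s(a, c) ∈ T) : IsFlipQuad P T a b c d := by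
  refine ⟨h.isTriangleOf hac, ?_, ?_, h.convexPosition⟩
  · exact (h.rotate.rotate.isTriangleOf (Sym2.eq_swap ▸ hac)).rotate.rotate
  · rintro rfl
    have := h.dab
    simp [signedArea_self_left] at this

theorem IsFlipQuad.isQuad_of_pos {P : Set Pt} {T : Set (Sym2 Pt)} (hT : ValidEdgeSet P T)
    {a b c d : Pt} (h : IsFlipQuad P T a b c d) (hpos : 0 < signedArea a b c) :
    IsQuad P T a b c d := by
  obtain ⟨hb, hd, hne, hconv⟩ := h
  have hd0 := hd.signedArea_ne_zero
  have e₁ : signedArea c a b = signedArea a b c := by unfold signedArea; ring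
  have e₂ : signedArea c a d = -signedArea a c d := by unfold signedArea; ring
  have e₃ : signedArea c d a = signedArea a c d := by unfold signedArea; ring
  have e₄ : signedArea d a c = signedArea a c d := by unfold signedArea; ring
  have e₅ : signedArea d b a = -signedArea d a b := by unfold signedArea; ring
  have e₆ : signedArea b d c = -signedArea b c d := by unfold signedArea; ring
  have e₇ : signedArea b c a = signedArea a b c := by unfold signedArea; ring
  have e₈ := signedArea_add a b d c
  have e₉ : signedArea a b d = signedArea d a b := by unfold signedArea; ring
  have hd' : 0 < signedArea a c d := by
    by_contra hcon
    refine hne (IsTriangleOf.apex_unique hT (a := c) (c := a) hb.rotate.rotate hd.swap ?_ ?_)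
    · linarith
    · have : signedArea a c d < 0 := lt_of_le_of_ne (not_lt.1 hcon) hd0
      linarith
  have hca : c ≠ a := by rintro rfl; simp [signedArea_self_left] at hpos
  have hcb : c ≠ b := by rintro rfl; simp [signedArea_self_right] at hpos
  have hab : a ≠ b := by rintro rfl; simp [signedArea_self] at hpos
  have hcd : c ≠ d := by rintro rfl; simp [signedArea_self_right] at hd'
  have had : a ≠ d := by rintro rfl; simp [signedArea_self_left] at hd'
  have hbcd : 0 < signedArea b c d := by
    by_contra hcon
    refine hconv c (by simp) (convexHull_mono (s := {a, b, d}) ?_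
      (mem_convexHull_of_signedArea_nonneg ?_ hpos.le ?_ ?_))
    · rintro x (rfl | rfl | rfl) <;> simp [hca.symm, hcb.symm, hcd.symm]
    all_goals linarith
  have hdab : 0 < signedArea d a b := by
    by_contra hcon
    have e := signedArea_add b c d a
    have e' : signedArea d b a = - signedArea d a b := e₅
    refine hconv a (by simp) (convexHull_mono (s := {b, c, d}) ?_
      (mem_convexHull_of_signedArea_nonneg hbcd ?_ ?_ ?_))
    · rintro x (rfl | rfl | rfl) <;> simp [hca, hab.symm, had.symm]
    all_goals linarith
  refine ⟨hpos, hbcd, by linarith, hdab, hb.1, hb.2.1, hd.2.1, Sym2.eq_swap ▸ hd.2.2.1, ?_⟩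
  intro p hp h₁ h₂ h₃ h₄
  rcases le_total 0 (signedArea c a p) with hside | hside
  · have := hb.2.2.2.2 p hp (mem_convexHull_of_signedArea_nonneg hpos h₁ h₂ hside)
    tauto
  · have e : signedArea a c p = -signedArea c a p := by unfold signedArea; ring
    have := hd.2.2.2.2 p hp (mem_convexHull_of_signedArea_nonneg hd' (by linarith) h₃ h₄)
    tauto

theorem IsFlipQuad.symm {P : Set Pt} {T : Set (Sym2 Pt)} {a b c d : Pt}
    (h : IsFlipQuad P T a b c d) : IsFlipQuad P T a d c b := by
  obtain ⟨hb, hd, hne, hconv⟩ := h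
  refine ⟨hd.swap.rotate.rotate.swap.rotate.swap, ?_, hne.symm, ?_⟩
  · exact hb.rotate.rotate.swap
  · rwa [show ({a, d, c, b} : Set Pt) = {a, b, c, d} by ext; simp; tauto]

theorem flipsTo_iff {P : Set Pt} {T T' : Set (Sym2 Pt)} {f : FlipData} :
    FlipsTo P T T' f ↔ IsTriangulation P T ∧ ∃ a b c d, IsQuad P T a b c d ∧ s(a, c) ∈ T ∧
      f = (s(a, c), s(b, d)) ∧ T' = (T \ {f.1}) ∪ {f.2} := by
  constructor
  · rintro ⟨hT, hf, a, b, c, d, hq, h₁, h₂, h⟩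
    refine ⟨hT, ?_⟩
    rcases lt_or_gt_of_ne hq.1.signedArea_ne_zero with hneg | hpos
    · have e : signedArea a d c = -signedArea a c d := signedArea_swap _ _ _
      have hq' := hq.symm
      rcases lt_or_gt_of_ne hq'.1.signedArea_ne_zero with hneg' | hpos'
      · exfalso
        refine hq.2.2.1 (IsTriangleOf.apex_unique hT.1 (a := a) (c := c)
          hq'.2.1 hq.2.1 ?_ ?_)
        · have e' : signedArea a c b = -signedArea a b c := signedArea_swap _ _ _
          linarith
        · linarith
      · exact ⟨a, d, c, b, hq'.isQuad_of_pos hT.1 hpos', h₁ ▸ hf,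
          Prod.ext h₁ (h₂.trans Sym2.eq_swap), h⟩
    · exact ⟨a, b, c, d, hq.isQuad_of_pos hT.1 hpos, h₁ ▸ hf, Prod.ext h₁ h₂, h⟩
  · rintro ⟨hT, a, b, c, d, hq, hac, rfl, h⟩
    exact ⟨hT, hac, a, b, c, d, hq.isFlipQuad hac, rfl, rfl, h⟩

theorem mem_segment_of_signedArea {a b c d y : Pt} (h₁ : 0 < signedArea a b c)
    (h₄ : 0 < signedArea d a b) (hy₁ : signedArea a b y = 0) (hy₂ : 0 ≤ signedArea b c y)
    (hy₄ : 0 ≤ signedArea d a y) : y ∈ segment ℝ a b := by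
  have hab : a ≠ b := by rintro rfl; simp [signedArea_self] at h₁
  obtain ⟨t, rfl⟩ : ∃ t : ℝ, y = (1 - t) • a + t • b := by
    have hcol : Collinear ℝ ({a, b, y} : Set Pt) := (collinear_iff_signedArea _ _ _).2 hy₁
    have := (hcol.mem_affineSpan_of_mem_of_ne (p₁ := a) (p₂ := b) (p₃ := y)
      (by simp) (by simp) (by simp) hab)
    obtain ⟨t, ht⟩ := mem_affineSpan_pair_iff_exists_lineMap_eq.1 this
    refine ⟨t, ?_⟩
    rw [← ht, AffineMap.lineMap_apply_module]
  rw [signedArea_combo _ _ _ _ (by ring)] at hy₂ hy₄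
  rw [signedArea_self_left] at hy₂
  rw [signedArea_self_right] at hy₄
  rw [signedArea_rotate] at hy₂
  refine ⟨1 - t, t, ?_, ?_, by ring, rfl⟩
  · by_contra hcon
    nlinarith
  · by_contra hcon
    nlinarith

/-- Interior points of the quadrilateral `a b c d`. -/
def QuadInterior (a b c d : Pt) : Set Pt :=
  {x | 0 < signedArea a b x ∧ 0 < signedArea b c x ∧ 0 < signedArea c d x ∧ 0 < signedArea d a x}

/-- The sides of the quadrilateral `a b c d`. -/
def quadSides (a b c d : Pt) : Set (Sym2 Pt) := {s(a, b), s(b, c), s(c, d), s(d, a)}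

theorem QuadInterior.rotate {a b c d x : Pt} (h : x ∈ QuadInterior a b c d) :
    x ∈ QuadInterior b c d a := ⟨h.2.1, h.2.2.1, h.2.2.2, h.1⟩

theorem signedArea_of_mem_segment {a b y : Pt} (h : y ∈ segment ℝ a b) :
    signedArea a b y = 0 := by
  obtain ⟨s, t, -, -, hst, rfl⟩ := h
  rw [signedArea_combo _ _ _ _ hst, signedArea_self_left, signedArea_self_right]
  ring

theorem QuadInterior.not_mem_side {a b c d x : Pt} (h : x ∈ QuadInterior a b c d)
    {g : Sym2 Pt} (hg : g ∈ quadSides a b c d) : x ∉ segOf g := by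
  obtain ⟨h₁, h₂, h₃, h₄⟩ := h
  intro hx
  rcases hg with rfl | rfl | rfl | rfl <;>
  · have := signedArea_of_mem_segment hx
    linarith

theorem IsQuad.not_mem_interior {P : Set Pt} {T : Set (Sym2 Pt)} {a b c d p : Pt}
    (h : IsQuad P T a b c d) (hp : p ∈ P) : p ∉ QuadInterior a b c d := by
  rintro ⟨h₁, h₂, h₃, h₄⟩
  rcases h.empty p hp h₁.le h₂.le h₃.le h₄.le with rfl | rfl | rfl | rfl <;>
    simp [signedArea_self_left, signedArea_self_right] at *

theorem IsQuad.exists_mem_side {P : Set Pt} {T : Set (Sym2 Pt)} {a b c d x p : Pt}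
    (h : IsQuad P T a b c d) (hx : x ∈ QuadInterior a b c d) (hp : p ∉ QuadInterior a b c d) :
    ∃ y ∈ segment ℝ x p, ∃ g ∈ quadSides a b c d, y ∈ segOf g := by
  let z : ℝ → Pt := fun t => (1 - t) • x + t • p
  let f : ℝ → ℝ := fun t => min (min (signedArea a b (z t)) (signedArea b c (z t)))
    (min (signedArea c d (z t)) (signedArea d a (z t)))
  have hf : Continuous f := by
    have hz : ∀ u v : Pt, Continuous fun t => signedArea u v (z t) := by
      intro u v
      have : (fun t => signedArea u v (z t)) =
          fun t => (1 - t) * signedArea u v x + t * signedArea u v p :=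
        funext fun t => signedArea_combo _ _ _ _ (by ring)
      rw [this]
      fun_prop
    exact ((hz _ _).min (hz _ _)).min ((hz _ _).min (hz _ _))
  have h0 : 0 ≤ f 0 := by
    obtain ⟨h₁, h₂, h₃, h₄⟩ := hx
    simp [f, z, h₁.le, h₂.le, h₃.le, h₄.le]
  have h1 : f 1 ≤ 0 := by
    by_contra hcon
    apply hp
    simpa [f, z, QuadInterior, and_assoc] using hcon
  obtain ⟨t, ⟨ht0, ht1⟩, ht⟩ :=
    intermediate_value_Icc' (zero_le_one (α := ℝ)) hf.continuousOn ⟨h1, h0⟩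
  refine ⟨z t, ⟨1 - t, t, by linarith, ht0, by ring, rfl⟩, ?_⟩
  have hge : 0 ≤ f t := ht.ge
  simp only [f, le_min_iff] at hge
  obtain ⟨⟨g₁, g₂⟩, g₃, g₄⟩ := hge
  have hz : signedArea a b (z t) = 0 ∨ signedArea b c (z t) = 0 ∨ signedArea c d (z t) = 0 ∨
      signedArea d a (z t) = 0 := by
    by_contra! hcon
    refine absurd ht (ne_of_gt ?_)
    simp only [f, lt_min_iff]
    exact ⟨⟨g₁.lt_of_ne' hcon.1, g₂.lt_of_ne' hcon.2.1⟩, g₃.lt_of_ne' hcon.2.2.1,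
      g₄.lt_of_ne' hcon.2.2.2⟩
  rcases hz with hz | hz | hz | hz
  · exact ⟨s(a, b), by simp [quadSides], mem_segment_of_signedArea h.abc h.dab hz g₂ g₄⟩
  · exact ⟨s(b, c), by simp [quadSides], mem_segment_of_signedArea h.bcd h.abc hz g₃ g₁⟩
  · exact ⟨s(c, d), by simp [quadSides], mem_segment_of_signedArea h.cda h.bcd hz g₄ g₂⟩
  · exact ⟨s(d, a), by simp [quadSides], mem_segment_of_signedArea h.dab h.cda hz g₁ g₃⟩

theorem mem_corners_of_mem_side {a b c d p : Pt} {g : Sym2 Pt} (hg : g ∈ quadSides a b c d)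
    (hp : p ∈ g) : p = a ∨ p = b ∨ p = c ∨ p = d := by
  rcases hg with rfl | rfl | rfl | rfl <;> rcases Sym2.mem_iff.1 hp with rfl | rfl <;> simp

/-- A segment between points of `P` that is compatible with the sides of an empty convex
quadrilateral and enters its interior is one of the two diagonals. -/
theorem IsQuad.eq_diagonal {P : Set Pt} {T : Set (Sym2 Pt)} {a b c d x : Pt} {e : Sym2 Pt}
    (h : IsQuad P T a b c d) (heP : ∀ p ∈ e, p ∈ P) (he : ¬ e.IsDiag)
    (hE : ∀ g ∈ quadSides a b c d, e ≠ g → ∀ y, y ∈ segOf e → y ∈ segOf g → y ∈ e ∧ y ∈ g)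
    (hx : x ∈ QuadInterior a b c d) (hxe : x ∈ segOf e) : e = s(a, c) ∨ e = s(b, d) := by
  have hside : ∀ g ∈ quadSides a b c d, e ≠ g := by
    rintro g hg rfl
    exact QuadInterior.not_mem_side hx hg hxe
  have key : ∀ p q : Pt, e = s(p, q) → p = a ∨ p = b ∨ p = c ∨ p = d := by
    rintro p q rfl
    obtain ⟨y, hy, g, hg, hyg⟩ :=
      h.exists_mem_side hx (h.not_mem_interior (heP p (Sym2.mem_mk_left _ _)))
    have hype : y ∈ segment ℝ p q :=
      (convex_segment p q).segment_subset hxe (left_mem_segment ℝ p q) hy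
    obtain ⟨hye, hyg'⟩ := hE g hg (hside g hg) y hype hyg
    rcases Sym2.mem_iff.1 hye with rfl | rfl
    · exact mem_corners_of_mem_side hg hyg'
    · exfalso
      have hxy : x = y := by
        have h₁ : Wbtw ℝ p x y := mem_segment_iff_wbtw.1 hxe
        have h₂ : Wbtw ℝ x y p := mem_segment_iff_wbtw.1 hy
        exact (wbtw_swap_left_iff ℝ p).1 ⟨h₂, h₁.symm⟩
      exact QuadInterior.not_mem_side hx hg (hxy ▸ hyg)
  induction e using Sym2.ind with
  | _ p q =>
    have hp := key p q rfl
    have hq := key q p Sym2.eq_swap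
    have hpq : p ≠ q := he
    have n₁ := hside s(a, b) (by simp [quadSides])
    have n₂ := hside s(b, c) (by simp [quadSides])
    have n₃ := hside s(c, d) (by simp [quadSides])
    have n₄ := hside s(d, a) (by simp [quadSides])
    rcases hp with rfl | rfl | rfl | rfl <;> rcases hq with rfl | rfl | rfl | rfl <;>
      simp_all [Sym2.eq_swap]

theorem IsQuad.openSegment_subset {P : Set Pt} {T : Set (Sym2 Pt)} {a b c d : Pt}
    (h : IsQuad P T a b c d) : openSegment ℝ a c ⊆ QuadInterior a b c d := by
  rintro x ⟨s, t, hs, ht, hst, rfl⟩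
  have h₁ := h.abc
  have h₂ := h.bcd
  have h₃ := h.cda
  have h₄ := h.dab
  simp only [QuadInterior, Set.mem_ofPred_eq, signedArea_combo _ _ _ _ hst, signedArea_self_left,
    signedArea_self_right, signedArea_rotate a b c,
    show signedArea d a c = signedArea c d a by unfold signedArea; ring]
  refine ⟨?_, ?_, ?_, ?_⟩ <;> simp <;> positivity

theorem mem_openSegOf {e : Sym2 Pt} {x : Pt} (h : x ∈ segOf e) (hx : x ∉ e) :
    x ∈ openSegOf e := by
  induction e using Sym2.ind with
  | _ p q =>
    simp only [Sym2.mem_iff, not_or] at hx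
    exact mem_openSegment_of_ne_left_right (Ne.symm hx.1) (Ne.symm hx.2) h

theorem IsQuad.sides_subset {P : Set Pt} {T : Set (Sym2 Pt)} {a b c d : Pt}
    (h : IsQuad P T a b c d) : quadSides a b c d ⊆ T := by
  rintro g (rfl | rfl | rfl | rfl)
  exacts [h.ab_mem, h.bc_mem, h.cd_mem, h.da_mem]

theorem IsQuad.not_mem_sides {P : Set Pt} {T : Set (Sym2 Pt)} {a b c d : Pt}
    (h : IsQuad P T a b c d) : s(a, c) ∉ quadSides a b c d := by
  have h₁ := h.abc
  have h₂ := h.bcd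
  have h₃ := h.cda
  have h₄ := h.dab
  have n₁ : b ≠ c := by rintro rfl; simp [signedArea_self_right] at h₁
  have n₂ : c ≠ d := by rintro rfl; simp [signedArea_self_right] at h₂
  have n₃ : d ≠ a := by rintro rfl; simp [signedArea_self_right] at h₃
  have n₄ : a ≠ b := by rintro rfl; simp [signedArea_self_right] at h₄
  simp only [quadSides, Set.mem_insert_iff, Set.mem_singleton_iff, Sym2.eq_iff, not_or]
  grind

theorem IsQuad.congr {P : Set Pt} {T T' : Set (Sym2 Pt)} {a b c d : Pt}
    (h : IsQuad P T a b c d) (hs : quadSides a b c d ⊆ T') : IsQuad P T' a b c d :=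
  { h with
    ab_mem := hs (by simp [quadSides])
    bc_mem := hs (by simp [quadSides])
    cd_mem := hs (by simp [quadSides])
    da_mem := hs (by simp [quadSides]) }

theorem IsQuad.flip {P : Set Pt} {T : Set (Sym2 Pt)} {a b c d : Pt} (h : IsQuad P T a b c d) :
    IsQuad P ((T \ {s(a, c)}) ∪ {s(b, d)}) a b c d :=
  h.congr fun _ hg => Or.inl ⟨h.sides_subset hg, fun he => h.not_mem_sides (he ▸ hg)⟩

theorem IsQuad.isTriangulation_flip {P : Set Pt} {T : Set (Sym2 Pt)} {a b c d : Pt}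
    (hT : IsTriangulation P T) (h : IsQuad P T a b c d) (hac : s(a, c) ∈ T) :
    IsTriangulation P ((T \ {s(a, c)}) ∪ {s(b, d)}) := by
  obtain ⟨⟨hd, hP, hX, hO⟩, hmax⟩ := hT
  have hbdT := h.not_mem_diagonal ⟨hd, hP, hX, hO⟩ hac
  have hbP : b ∈ P := hP _ h.ab_mem b (Sym2.mem_mk_right _ _)
  have hdP : d ∈ P := hP _ h.cd_mem d (Sym2.mem_mk_right _ _)
  have hsub : openSegment ℝ b d ⊆ QuadInterior a b c d := fun x hx =>
    QuadInterior.rotate (QuadInterior.rotate (QuadInterior.rotate (h.rotate.openSegment_subset hx)))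
  have hbd : ∀ e ∈ T, e ≠ s(a, c) → ∀ x, x ∈ segOf e → x ∈ segOf s(b, d) →
      x ∈ e ∧ x ∈ s(b, d) := by
    intro e he hne x hxe hx
    have hxbd : x ∈ s(b, d) := by
      by_contra hcon
      rcases h.eq_diagonal (hP e he) (hd e he)
        (fun g hg hge y hy hy' => hX e he g (h.sides_subset hg) hge y hy hy')
        (hsub (mem_openSegOf hx hcon)) hxe with h' | h'
      · exact hne h'
      · exact hbdT (h' ▸ he)
    refine ⟨?_, hxbd⟩
    by_contra hcon
    refine hO e he x ?_ (mem_openSegOf hxe hcon)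
    rcases Sym2.mem_iff.1 hxbd with rfl | rfl <;> assumption
  refine ⟨⟨?_, ?_, ?_, ?_⟩, ?_⟩
  · rintro e (⟨he, -⟩ | rfl)
    · exact hd e he
    · rintro hdiag
      have hbd' : b = d := hdiag
      have := h.dab
      simp [hbd', signedArea_self_left] at this
  · rintro e (⟨he, -⟩ | rfl) x hx
    · exact hP e he x hx
    · rcases Sym2.mem_iff.1 hx with rfl | rfl <;> assumption
  · rintro e (⟨he, hne⟩ | rfl) f (⟨hf, hnf⟩ | rfl) hef x hx hx'
    · exact hX e he f hf hef x hx hx'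
    · exact hbd e he hne x hx hx'
    · exact (hbd f hf hnf x hx' hx).symm
    · exact absurd rfl hef
  · rintro e (⟨he, -⟩ | rfl) p hp hmem
    · exact hO e he p hp hmem
    · exact h.not_mem_interior hp (hsub hmem)
  · intro T' hT' hTT'
    refine (Set.Subset.antisymm hTT' ?_).symm
    obtain ⟨hd', hP', hX', hO'⟩ := hT'
    have hq' := h.flip.congr (h.flip.sides_subset.trans hTT')
    have hacT' : s(a, c) ∉ T' := by
      refine hq'.rotate.not_mem_diagonal (a := b) (c := d) ⟨hd', hP', hX', hO'⟩
        (hTT' (Or.inr rfl)) ∘ fun h => ?_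
      rwa [Sym2.eq_swap]
    intro e he
    by_contra hcon
    have hne : e ≠ s(a, c) := by rintro rfl; exact hacT' he
    have hnbd : e ≠ s(b, d) := fun h => hcon (Or.inr h)
    have heT : e ∉ T := fun h => hcon (Or.inl ⟨h, hne⟩)
    have heac : ∀ x, x ∈ segOf e → x ∈ segOf s(a, c) → x ∈ e ∧ x ∈ s(a, c) := by
      intro x hxe hx
      have hxac : x ∈ s(a, c) := by
        by_contra hcon
        rcases hq'.eq_diagonal (hP' e he) (hd' e he)
          (fun g hg hge y hy hy' => hX' e he g (hq'.sides_subset hg) hge y hy hy')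
          (h.openSegment_subset (mem_openSegOf hx hcon)) hxe with h' | h'
        · exact hne h'
        · exact hnbd h'
      refine ⟨?_, hxac⟩
      by_contra hcon
      exact hO' e he x (hP _ hac x hxac) (mem_openSegOf hxe hcon)
    have hin : ∀ g ∈ T, g ≠ s(a, c) → g ∈ T' := fun g hg hne => hTT' (Or.inl ⟨hg, hne⟩)
    have hins : insert e T = T := by
      refine hmax _ ⟨?_, ?_, ?_, ?_⟩ (Set.subset_insert _ _)
      · rintro g (rfl | hg)
        exacts [hd' g he, hd g hg]
      · rintro g (rfl | hg)
        exacts [hP' g he, hP g hg]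
      · have key : ∀ g ∈ T, e ≠ g → ∀ x, x ∈ segOf e → x ∈ segOf g → x ∈ e ∧ x ∈ g := by
          intro g hg heg x hx hx'
          by_cases hgac : g = s(a, c)
          · subst hgac
            exact heac x hx hx'
          · exact hX' e he g (hin g hg hgac) heg x hx hx'
        rintro g (rfl | hg) g' (rfl | hg') hne x hx hx'
        · exact absurd rfl hne
        · exact key g' hg' hne x hx hx'
        · exact (key g hg hne.symm x hx' hx).symm
        · exact hX g hg g' hg' hne x hx hx'
      · rintro g (rfl | hg)
        exacts [hO' g he, hO g hg]
    exact heT (hins ▸ Set.mem_insert e T)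

theorem ShareTriangle.symm {P : Set Pt} {T : Set (Sym2 Pt)} {e f : Sym2 Pt}
    (h : ShareTriangle P T e f) : ShareTriangle P T f e := by
  obtain ⟨a, b, c, h, he, hf⟩ := h
  exact ⟨a, b, c, h, hf, he⟩

theorem ShareTriangle.exists_apex {P : Set Pt} {T : Set (Sym2 Pt)} {a c : Pt} {e : Sym2 Pt}
    (h : ShareTriangle P T s(a, c) e) :
    ∃ x, IsTriangleOf P T a c x ∧ (e = s(a, c) ∨ e = s(c, x) ∨ e = s(a, x)) := by
  obtain ⟨x, y, z, ht, h₁, h₂⟩ := h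
  have ht' := ht.rotate
  have ht'' := ht.rotate.rotate
  rcases h₁ with h₁ | h₁ | h₁ <;> rcases Sym2.eq_iff.1 h₁ with ⟨rfl, rfl⟩ | ⟨rfl, rfl⟩
  · exact ⟨z, ht, h₂⟩
  · exact ⟨z, ht.swap, by rcases h₂ with rfl | rfl | rfl <;> simp [Sym2.eq_swap]⟩
  · exact ⟨x, ht', by rcases h₂ with rfl | rfl | rfl <;> simp [Sym2.eq_swap]⟩
  · exact ⟨x, ht'.swap, by rcases h₂ with rfl | rfl | rfl <;> simp [Sym2.eq_swap]⟩
  · exact ⟨y, ht''.swap, by rcases h₂ with rfl | rfl | rfl <;> simp [Sym2.eq_swap]⟩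
  · exact ⟨y, ht'', by rcases h₂ with rfl | rfl | rfl <;> simp [Sym2.eq_swap]⟩

theorem FlipsTo.eq {P : Set Pt} {T T₁ : Set (Sym2 Pt)} {f : FlipData} (h : FlipsTo P T T₁ f) :
    T₁ = (T \ {f.1}) ∪ {f.2} := by
  obtain ⟨-, -, a, b, c, d, -, -, -, h⟩ := h
  exact h

theorem FlipsTo.resulting_not_mem {P : Set Pt} {T T₁ : Set (Sym2 Pt)} {f : FlipData}
    (h : FlipsTo P T T₁ f) : f.2 ∉ T := by
  obtain ⟨hT, a, b, c, d, hq, hac, rfl, h⟩ := flipsTo_iff.1 h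
  exact hq.not_mem_diagonal hT.1 hac

theorem FlipsTo.isTriangulation {P : Set Pt} {T T₁ : Set (Sym2 Pt)} {f : FlipData}
    (h : FlipsTo P T T₁ f) : IsTriangulation P T₁ := by
  obtain ⟨hT, a, b, c, d, hq, hac, rfl, rfl⟩ := flipsTo_iff.1 h
  exact hq.isTriangulation_flip hT hac

theorem sdiff_union_sdiff_union {α : Type*} {T : Set α} {u v : α} (hu : u ∈ T) (hv : v ∉ T) :
    (((T \ {u}) ∪ {v}) \ {v}) ∪ {u} = T := by
  ext e
  simp only [Set.mem_union, Set.mem_sdiff, Set.mem_singleton_iff]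
  by_cases h₁ : e = u <;> by_cases h₂ : e = v <;> simp_all

theorem FlipsTo.reverse {P : Set Pt} {T T₁ : Set (Sym2 Pt)} {f : FlipData}
    (h : FlipsTo P T T₁ f) : FlipsTo P T₁ T (f.2, f.1) := by
  have hT₁ := h.isTriangulation
  have hf := h.resulting_not_mem
  obtain ⟨hT, a, b, c, d, hq, hac, rfl, rfl⟩ := flipsTo_iff.1 h
  refine flipsTo_iff.2 ⟨hT₁, b, c, d, a, hq.flip.rotate, Or.inr rfl, by simp [Sym2.eq_swap], ?_⟩
  exact (sdiff_union_sdiff_union hac hf).symm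

/-- The sides of the quadrilateral of a flip share a triangle with the resulting edge. -/
theorem FlipsTo.shareTriangle {P : Set Pt} {T T₁ : Set (Sym2 Pt)} {f : FlipData}
    (h : FlipsTo P T T₁ f) {e : Sym2 Pt} (hne : e ≠ f.1) (he : ShareTriangle P T f.1 e) :
    ShareTriangle P T₁ f.2 e := by
  obtain ⟨hT, a, b, c, d, hq, hac, rfl, rfl⟩ := flipsTo_iff.1 h
  obtain ⟨x, hx, hex⟩ := he.exists_apex
  have hbcd := hq.flip.rotate.isTriangleOf (Or.inr rfl)
  have hdab := hq.flip.rotate.rotate.rotate.isTriangleOf (Or.inr Sym2.eq_swap)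
  rcases lt_or_gt_of_ne hx.signedArea_ne_zero with hneg | hpos
  · have hb := (hq.isTriangleOf hac).rotate.rotate
    obtain rfl : b = x := by
      refine hb.apex_unique hT.1 hx.swap ?_ ?_
      · rw [← signedArea_rotate]; exact hq.abc
      · have : signedArea c a x = -signedArea a c x := by unfold signedArea; ring
        linarith
    rcases hex with rfl | rfl | rfl
    · exact absurd rfl hne
    · exact ⟨_, _, _, hbcd, Or.inr (Or.inr rfl), Or.inl Sym2.eq_swap⟩
    · exact ⟨_, _, _, hdab, Or.inr (Or.inr Sym2.eq_swap), Or.inr (Or.inl rfl)⟩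
  · have hd := (hq.rotate.rotate.isTriangleOf (Sym2.eq_swap ▸ hac)).rotate.rotate
    obtain rfl : d = x := by
      refine hd.apex_unique hT.1 hx ?_ hpos
      rw [← signedArea_rotate]; exact hq.cda
    rcases hex with rfl | rfl | rfl
    · exact absurd rfl hne
    · exact ⟨_, _, _, hbcd, Or.inr (Or.inr rfl), Or.inr (Or.inl rfl)⟩
    · exact ⟨_, _, _, hdab, Or.inr (Or.inr Sym2.eq_swap), Or.inl Sym2.eq_swap⟩

theorem ShareTriangle.of_forall_mem {P : Set Pt} {T T' : Set (Sym2 Pt)} {e f : Sym2 Pt}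
    (h : ShareTriangle P T e f) (hTT' : ∀ g ∈ T, ShareTriangle P T f g → g ∈ T') :
    ShareTriangle P T' e f := by
  obtain ⟨a, b, c, ht, he, hf⟩ := h
  refine ⟨a, b, c, ⟨?_, ?_, ?_, ht.2.2.2⟩, he, hf⟩
  · exact hTT' _ ht.1 ⟨a, b, c, ht, hf, Or.inl rfl⟩
  · exact hTT' _ ht.2.1 ⟨a, b, c, ht, hf, Or.inr (Or.inl rfl)⟩
  · exact hTT' _ ht.2.2.1 ⟨a, b, c, ht, hf, Or.inr (Or.inr rfl)⟩

/-- A flip remains applicable in every triangulation that keeps the edges sharing a triangle with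
its underlying edge. -/
theorem FlipsTo.transfer {P : Set Pt} {T T₁ T' : Set (Sym2 Pt)} {f : FlipData}
    (h : FlipsTo P T T₁ f) (hT' : IsTriangulation P T')
    (hTT' : ∀ g ∈ T, ShareTriangle P T f.1 g → g ∈ T') :
    FlipsTo P T' ((T' \ {f.1}) ∪ {f.2}) f := by
  obtain ⟨-, hf, a, b, c, d, ⟨hb, hd, hq⟩, h₁, h₂, -⟩ := h
  have tr : ∀ x y z, IsTriangleOf P T x y z → EdgeOfTriangle f.1 x y z →
      IsTriangleOf P T' x y z := fun x y z ht he =>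
    ⟨hTT' _ ht.1 ⟨x, y, z, ht, he, Or.inl rfl⟩,
      hTT' _ ht.2.1 ⟨x, y, z, ht, he, Or.inr (Or.inl rfl)⟩,
      hTT' _ ht.2.2.1 ⟨x, y, z, ht, he, Or.inr (Or.inr rfl)⟩, ht.2.2.2⟩
  refine ⟨hT', ?_, a, b, c, d, ⟨tr _ _ _ hb (Or.inr (Or.inr h₁)), tr _ _ _ hd (Or.inl h₁), hq⟩,
    h₁, h₂, rfl⟩
  exact hTT' _ hf ⟨a, b, c, hb, Or.inr (Or.inr h₁), Or.inr (Or.inr h₁)⟩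

/-- Two consecutive flips of which the second does not depend on the first commute, and neither
of their edges interferes with the other flip. -/
theorem FlipsTo.commute {P : Set Pt} {T T₁ T₂ : Set (Sym2 Pt)} {f g : FlipData}
    (hf : FlipsTo P T T₁ f) (hg : FlipsTo P T₁ T₂ g) (hne : f.2 ≠ g.1)
    (hsh : ¬ ShareTriangle P T₁ f.2 g.1) :
    FlipsTo P T ((T \ {g.1}) ∪ {g.2}) g ∧ FlipsTo P ((T \ {g.1}) ∪ {g.2}) T₂ f ∧
      f.1 ≠ g.1 ∧ f.1 ≠ g.2 ∧ ¬ ShareTriangle P T f.1 g.1 ∧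
      ¬ ShareTriangle P ((T \ {g.1}) ∪ {g.2}) g.2 f.1 := by
  have hfT : f.1 ∈ T := hf.2.1
  have hgT₁ := hg.2.1
  have hf₂ := hf.resulting_not_mem
  have eT₁ := hf.eq
  have eT₂ := hg.eq
  have hgT : g.1 ∈ T ∧ g.1 ≠ f.1 := by
    rw [eT₁] at hgT₁
    exact hgT₁.resolve_right hne.symm
  have hA : ¬ ShareTriangle P T f.1 g.1 := fun h => hsh (hf.shareTriangle hgT.2 h)
  have hg' : FlipsTo P T ((T \ {g.1}) ∪ {g.2}) g := by
    refine hg.transfer hf.1 fun e he hs => ?_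
    rw [eT₁] at he
    refine he.elim (fun h => h.1) fun h => ?_
    have h' : e = f.2 := h
    exact absurd (h' ▸ hs.symm) hsh
  have hg₂ := hg'.resulting_not_mem
  have hfg : f.1 ≠ g.2 := fun h => hg₂ (h ▸ hfT)
  refine ⟨hg', ?_, hgT.2.symm, hfg, hA, fun h => ?_⟩
  · have hf' := hf.transfer hg'.isTriangulation fun e he hs => Or.inl ⟨he, ?_⟩
    · convert hf' using 1
      rw [eT₂, eT₁]
      ext e
      simp only [Set.mem_union, Set.mem_sdiff, Set.mem_singleton_iff]
      by_cases h₁ : e = f.1 <;> by_cases h₂ : e = g.2 <;> by_cases h₃ : e = f.2 <;>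
        by_cases h₄ : e = g.1 <;> simp_all
    · intro h
      have h' : e = g.1 := h
      exact hA (h' ▸ hs)
  · exact hA (hg'.reverse.shareTriangle hfg h).symm

/-- The edge set reached from `T₀` by the first `n` flips of the sequence `φ`. -/
def flipState (T₀ : Set (Sym2 Pt)) (φ : ℕ → FlipData) : ℕ → Set (Sym2 Pt)
  | 0 => T₀
  | n + 1 => (flipState T₀ φ n \ {(φ n).1}) ∪ {(φ n).2}

/-- The first `r` flips of the sequence `φ` form a valid sequence from `T₀`. -/
def ValidFlips (P : Set Pt) (T₀ : Set (Sym2 Pt)) (φ : ℕ → FlipData) (r : ℕ) : Prop :=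
  ∀ n < r, FlipsTo P (flipState T₀ φ n) (flipState T₀ φ (n + 1)) (φ n)

/-- The arc relation of the flip dependency graph, for sequences of flips indexed by `ℕ`. -/
def FlipArc (P : Set Pt) (T₀ : Set (Sym2 Pt)) (φ : ℕ → FlipData) (i j : ℕ) : Prop :=
  i < j ∧ ((φ i).2 = (φ j).1 ∨ ShareTriangle P (flipState T₀ φ j) (φ i).2 (φ j).1) ∧
    ∀ p, i < p → p < j → (φ p).1 ≠ (φ i).2

theorem flipState_congr {T₀ : Set (Sym2 Pt)} {φ φ' : ℕ → FlipData} {n : ℕ}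
    (h : ∀ i < n, φ i = φ' i) : flipState T₀ φ n = flipState T₀ φ' n := by
  induction n with
  | zero => rfl
  | succ n ih => rw [flipState, flipState, ih fun i hi => h i (by omega), h n (by omega)]

theorem flipState_congr_of_ge {T₀ : Set (Sym2 Pt)} {φ φ' : ℕ → FlipData} {m n : ℕ} (hmn : m ≤ n)
    (hm : flipState T₀ φ m = flipState T₀ φ' m) (h : ∀ i, m ≤ i → φ i = φ' i) :
    flipState T₀ φ n = flipState T₀ φ' n := by
  induction n, hmn using Nat.le_induction with
  | base => exact hm
  | succ n hn ih => rw [flipState, flipState, ih, h n hn]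

/-- Swapping two consecutive flips not joined by an arc keeps a sequence valid and creates no
new arcs. -/
theorem ValidFlips.swap {P : Set Pt} {T₀ : Set (Sym2 Pt)} {φ : ℕ → FlipData} {r k : ℕ}
    (h : ValidFlips P T₀ φ r) (hk : k + 1 < r) (harc : ¬ FlipArc P T₀ φ k (k + 1)) :
    ValidFlips P T₀ (φ ∘ Equiv.swap k (k + 1)) r ∧
      ∀ i j, FlipArc P T₀ (φ ∘ Equiv.swap k (k + 1)) i j →
        FlipArc P T₀ φ (Equiv.swap k (k + 1) i) (Equiv.swap k (k + 1) j) := by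
  have hnot : ¬ ((φ k).2 = (φ (k + 1)).1 ∨
      ShareTriangle P (flipState T₀ φ (k + 1)) (φ k).2 (φ (k + 1)).1) := fun hcon =>
    harc ⟨by omega, hcon, fun p _ _ => by omega⟩
  rw [not_or] at hnot
  obtain ⟨hne, hsh⟩ := hnot
  obtain ⟨hg, hf, hfg₁, hfg₂, hA, hB⟩ :=
    (h k (by omega)).commute (h (k + 1) hk) hne hsh
  set φ' := φ ∘ Equiv.swap k (k + 1) with hφ'
  have s₁ : φ' k = φ (k + 1) := by simp [hφ']
  have s₂ : φ' (k + 1) = φ k := by simp [hφ']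
  have s₃ : ∀ n, n ≠ k → n ≠ k + 1 → φ' n = φ n := by
    intro n h₁ h₂
    simp [hφ', Equiv.swap_apply_of_ne_of_ne h₁ h₂]
  have t₁ : ∀ n, n ≤ k → flipState T₀ φ' n = flipState T₀ φ n := fun n hn =>
    flipState_congr fun i hi => s₃ i (by omega) (by omega)
  have t₂ : flipState T₀ φ' (k + 1) =
      (flipState T₀ φ k \ {(φ (k + 1)).1}) ∪ {(φ (k + 1)).2} := by
    rw [flipState, t₁ k le_rfl, s₁]
  rw [← t₂] at hg hf hB
  have t₃ : flipState T₀ φ' (k + 1 + 1) = flipState T₀ φ (k + 1 + 1) := by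
    rw [hf.eq, flipState, s₂]
  have t₄ : ∀ n, k + 1 < n → flipState T₀ φ' n = flipState T₀ φ n := fun n hn =>
    flipState_congr_of_ge hn t₃ fun i hi => s₃ i (by omega) (by omega)
  refine ⟨fun n hn => ?_, ?_⟩
  · rcases lt_trichotomy n k with hnk | rfl | hnk
    · rw [t₁ n hnk.le, t₁ (n + 1) hnk, s₃ n (by omega) (by omega)]
      exact h n hn
    · rw [t₁ n le_rfl, s₁]
      exact hg
    · rcases Nat.eq_or_lt_of_le hnk with rfl | hnk'
      · rw [t₃, s₂]
        exact hf
      · rw [t₄ n (by omega), t₄ (n + 1) (by omega), s₃ n (by omega) (by omega)]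
        exact h n hn
  · rintro i j ⟨hij, hs, hc⟩
    rcases lt_trichotomy j k with hj | rfl | hj
    · rw [Equiv.swap_apply_of_ne_of_ne (by omega) (by omega),
        Equiv.swap_apply_of_ne_of_ne (by omega) (by omega)]
      rw [s₃ i (by omega) (by omega)] at hs hc
      rw [s₃ j (by omega) (by omega), t₁ j hj.le] at hs
      refine ⟨hij, hs, fun p h₁ h₂ => ?_⟩
      rw [← s₃ p (by omega) (by omega)]
      exact hc p h₁ h₂
    · rw [Equiv.swap_apply_of_ne_of_ne (by omega) (by omega), Equiv.swap_apply_left]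
      rw [s₃ i (by omega) (by omega)] at hs hc
      rw [s₁, t₁ j le_rfl] at hs
      refine ⟨by omega, ?_, fun p h₁ h₂ => ?_⟩
      · refine hs.imp_right fun hs => hs.of_forall_mem fun e he hse => ?_
        refine Or.inl ⟨he, fun hef => ?_⟩
        have hef' : e = (φ j).1 := hef
        exact hA (hef' ▸ hse.symm)
      · rcases (Nat.le_of_lt_succ h₂).eq_or_lt with rfl | h₃
        · intro heq
          rw [← heq] at hs
          exact hs.elim hfg₁ hA
        · rw [← s₃ p (by omega) (by omega)]
          exact hc p h₁ h₃
    · rcases Nat.eq_or_lt_of_le hj with rfl | hj'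
      · rw [s₂] at hs
        rcases (Nat.le_of_lt_succ hij).eq_or_lt with rfl | hi
        · rw [s₁] at hs
          exact (hs.elim hfg₂.symm hB).elim
        · rw [Equiv.swap_apply_of_ne_of_ne (by omega) (by omega), Equiv.swap_apply_right]
          rw [s₃ i (by omega) (by omega)] at hs hc
          refine ⟨hi, ?_, fun p h₁ h₂ => ?_⟩
          · refine hs.imp_right fun hs => hs.of_forall_mem fun e he hse => ?_
            rw [t₂] at he
            refine he.elim (fun he => he.1) fun he => ?_
            have he' : e = (φ (k + 1)).2 := he
            exact absurd (he' ▸ hse.symm) hB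
          · rw [← s₃ p (by omega) (by omega)]
            exact hc p h₁ (by omega)
      · have hj'' : k + 1 < j := by omega
        rw [Equiv.swap_apply_of_ne_of_ne (x := j) (by omega) (by omega)]
        rw [s₃ j (by omega) (by omega), t₄ j hj''] at hs
        rcases eq_or_ne i k with rfl | hik
        · rw [Equiv.swap_apply_left]
          rw [s₁] at hs hc
          refine ⟨hj'', hs, fun p h₁ h₂ => ?_⟩
          rw [← s₃ p (by omega) (by omega)]
          exact hc p (by omega) h₂
        · rcases eq_or_ne i (k + 1) with rfl | hik'
          · rw [Equiv.swap_apply_right]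
            rw [s₂] at hs hc
            refine ⟨by omega, hs, fun p h₁ h₂ => ?_⟩
            rcases eq_or_ne p (k + 1) with rfl | hp
            · exact Ne.symm hne
            · rw [← s₃ p (by omega) hp]
              exact hc p (by omega) h₂
          · rw [Equiv.swap_apply_of_ne_of_ne hik hik']
            rw [s₃ i hik hik'] at hs hc
            refine ⟨hij, hs, fun p h₁ h₂ => ?_⟩
            rcases eq_or_ne p k with rfl | hp
            · rw [← s₂]
              exact hc (p + 1) (by omega) (by omega)
            · rcases eq_or_ne p (k + 1) with rfl | hp'
              · rw [← s₁]
                exact hc k (by omega) (by omega)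
              · rw [← s₃ p hp hp']
                exact hc p h₁ h₂

theorem eq_self_of_lt_succ_of_lt {r : ℕ} {τ : ℕ → ℕ} (hlt : ∀ i < r, τ i < r)
    (hmono : ∀ k, k + 1 < r → τ k < τ (k + 1)) {i : ℕ} (hi : i < r) : τ i = i := by
  have h₁ : ∀ i, i < r → i ≤ τ i := by
    intro i
    induction i with
    | zero => intro; omega
    | succ i ih =>
      intro h
      have := ih (by omega)
      have := hmono i h
      omega
  have h₂ : ∀ m i, i + m + 1 = r → τ i ≤ i := by
    intro m
    induction m with
    | zero =>
      intro i h
      have := hlt i (by omega)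
      omega
    | succ m ih =>
      intro i h
      have := ih (i + 1) (by omega)
      have := hmono i (by omega)
      omega
  exact le_antisymm (h₂ (r - 1 - i) i (by omega)) (h₁ i hi)

theorem sum_mul_lt_sum_mul_swap {r k : ℕ} {τ : ℕ → ℕ} (hk : k + 1 < r) (h : τ (k + 1) < τ k) :
    ∑ i ∈ Finset.range r, i * τ i <
      ∑ i ∈ Finset.range r, i * (τ ∘ Equiv.swap k (k + 1)) i := by
  have hsub : ({k, k + 1} : Finset ℕ) ⊆ Finset.range r := by
    intro i hi
    simp only [Finset.mem_insert, Finset.mem_singleton] at hi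
    simp only [Finset.mem_range]
    omega
  rw [← Finset.sum_sdiff hsub, ← Finset.sum_sdiff hsub]
  have h₁ : ∑ i ∈ Finset.range r \ {k, k + 1}, i * (τ ∘ Equiv.swap k (k + 1)) i =
      ∑ i ∈ Finset.range r \ {k, k + 1}, i * τ i := by
    refine Finset.sum_congr rfl fun i hi => ?_
    simp only [Finset.mem_sdiff, Finset.mem_insert, Finset.mem_singleton, not_or] at hi
    simp [Equiv.swap_apply_of_ne_of_ne hi.2.1 hi.2.2]
  rw [h₁, Finset.sum_pair (by omega), Finset.sum_pair (by omega)]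
  simp only [Function.comp_apply, Equiv.swap_apply_left, Equiv.swap_apply_right]
  nlinarith

/-- A topological sorting of the dependency graph of a valid flip sequence is valid. Here `τ i` is
the position in the sorting `ψ` of the `i`-th flip of `φ`. -/
theorem ValidFlips.of_topologicalSorting {P : Set Pt} {T₀ : Set (Sym2 Pt)} {r : ℕ}
    {ψ φ : ℕ → FlipData} {τ : ℕ → ℕ} (h : ValidFlips P T₀ φ r) (hlt : ∀ i < r, τ i < r)
    (hinj : ∀ i < r, ∀ j < r, τ i = τ j → i = j) (hψ : ∀ i < r, φ i = ψ (τ i))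
    (harc : ∀ i j, j < r → FlipArc P T₀ φ i j → τ i < τ j) : ValidFlips P T₀ ψ r := by
  generalize hm : r * (r * r) - ∑ i ∈ Finset.range r, i * τ i = m
  induction m using Nat.strong_induction_on generalizing φ τ with
  | _ m ih =>
    by_cases hmono : ∀ k, k + 1 < r → τ k < τ (k + 1)
    · have heq : ∀ i < r, φ i = ψ i := fun i hi => by
        rw [hψ i hi, eq_self_of_lt_succ_of_lt hlt hmono hi]
      intro n hn
      rw [← heq n hn, ← flipState_congr fun i hi => heq i (by omega),
        ← flipState_congr fun i hi => heq i (by omega)]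
      exact h n hn
    · push Not at hmono
      obtain ⟨k, hk, hle⟩ := hmono
      have hτ : τ (k + 1) < τ k := by
        refine lt_of_le_of_ne hle fun heq => ?_
        have := hinj _ hk _ (by omega) heq
        omega
      have hsw : ∀ i < r, Equiv.swap k (k + 1) i < r := by
        intro i hi
        rw [Equiv.swap_apply_def]
        split_ifs <;> omega
      obtain ⟨hv, ha⟩ := h.swap hk fun hcon => by
        have := harc _ _ hk hcon
        omega
      have hlt' : ∀ i < r, (τ ∘ Equiv.swap k (k + 1)) i < r := fun i hi => hlt _ (hsw i hi)
      refine ih _ ?_ hv hlt' (fun i hi j hj hij => ?_) (fun i hi => hψ _ (hsw i hi))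
        (fun i j hj hij => harc _ _ (hsw j hj) (ha i j hij)) rfl
      · have hbound : ∑ i ∈ Finset.range r, i * (τ ∘ Equiv.swap k (k + 1)) i ≤ r * (r * r) := by
          refine (Finset.sum_le_card_nsmul _ _ (r * r) fun i hi => ?_).trans (by simp)
          have hi' := Finset.mem_range.1 hi
          exact Nat.mul_le_mul hi'.le (hlt' i hi').le
        have := sum_mul_lt_sum_mul_swap hk hτ
        omega
      · exact (Equiv.swap k (k + 1)).injective (hinj _ (hsw i hi) _ (hsw j hj) hij)

theorem applyFlips_append (T : Set (Sym2 Pt)) (F G : List FlipData) :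
    applyFlips T (F ++ G) = applyFlips (applyFlips T F) G := by
  induction F generalizing T with
  | nil => rfl
  | cons f F ih => exact ih _

theorem flipState_eq_applyFlips {T₀ : Set (Sym2 Pt)} {F : List FlipData} {φ : ℕ → FlipData}
    (hφ : ∀ i (hi : i < F.length), φ i = F[i]) {n : ℕ} (hn : n ≤ F.length) :
    flipState T₀ φ n = applyFlips T₀ (F.take n) := by
  induction n with
  | zero => rfl
  | succ n ih =>
    rw [List.take_succ_eq_append_getElem hn, applyFlips_append, ← ih (by omega), flipState,
      hφ n hn]
    rfl

theorem ValidSeq.flipsTo {P : Set Pt} {T T' : Set (Sym2 Pt)} {F : List FlipData}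
    (h : ValidSeq P T F T') (n : ℕ) (hn : n < F.length) :
    FlipsTo P (applyFlips T (F.take n)) (applyFlips T (F.take (n + 1))) F[n] := by
  induction F generalizing T n with
  | nil => simp at hn
  | cons f F ih =>
    obtain ⟨T₁, hf, hF⟩ := h
    have e := hf.eq
    subst e
    cases n with
    | zero => exact hf
    | succ n => exact ih hF n (by simpa using hn)

theorem validSeq_of_flipsTo {P : Set Pt} {T : Set (Sym2 Pt)} {F : List FlipData}
    (h : ∀ n (hn : n < F.length),
      FlipsTo P (applyFlips T (F.take n)) (applyFlips T (F.take (n + 1))) F[n]) :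
    ValidSeq P T F (applyFlips T F) := by
  induction F generalizing T with
  | nil => rfl
  | cons f F ih =>
    refine ⟨_, h 0 (by simp), ih fun n hn => ?_⟩
    exact h (n + 1) (by simpa using hn)

theorem ValidSeq.validFlips {P : Set Pt} {T T' : Set (Sym2 Pt)} {F : List FlipData}
    {φ : ℕ → FlipData} (hφ : ∀ i (hi : i < F.length), φ i = F[i]) (h : ValidSeq P T F T') :
    ValidFlips P T φ F.length := by
  intro n hn
  rw [flipState_eq_applyFlips hφ hn.le, flipState_eq_applyFlips hφ hn, hφ n hn]
  exact h.flipsTo n hn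

theorem ValidFlips.validSeq_take {P : Set Pt} {T : Set (Sym2 Pt)} {F : List FlipData}
    {φ : ℕ → FlipData} (hφ : ∀ i (hi : i < F.length), φ i = F[i])
    (h : ValidFlips P T φ F.length) (j : ℕ) :
    ValidSeq P T (F.take j) (applyFlips T (F.take j)) := by
  refine validSeq_of_flipsTo fun n hn => ?_
  have hnj : n < j ∧ n < F.length := by simpa using hn
  have := h n hnj.2
  rw [flipState_eq_applyFlips hφ hnj.2.le, flipState_eq_applyFlips hφ hnj.2, hφ n hnj.2] at this
  rwa [List.take_take, List.take_take, min_eq_left (by omega), min_eq_left (by omega),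
    List.getElem_take]

theorem FlipArc.arc {P : Set Pt} {T : Set (Sym2 Pt)} {F : List FlipData} {φ : ℕ → FlipData}
    (hφ : ∀ i (hi : i < F.length), φ i = F[i]) {i j : ℕ} (hj : j < F.length)
    (h : FlipArc P T φ i j) : Arc P T F i j := by
  obtain ⟨hij, hs, hc⟩ := h
  rw [hφ i (by omega), hφ j hj, flipState_eq_applyFlips hφ hj.le] at hs
  refine ⟨by omega, hj, hij, hs, fun p hp h₁ h₂ => ?_⟩
  have := hc p h₁ h₂
  rwa [hφ i (by omega), hφ p hp] at this

/-- A topological sorting of the dependency graph of a valid flip sequence is valid. -/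
theorem IsTopologicalSorting.validFlips {P : Set Pt} {T T' : Set (Sym2 Pt)} {F F' : List FlipData}
    (h : IsTopologicalSorting P T F F') (hF : ValidSeq P T F T') {ψ : ℕ → FlipData}
    (hψ : ∀ i (hi : i < F'.length), ψ i = F'[i]) : ValidFlips P T ψ F'.length := by
  obtain ⟨hlen, σ, hσ, harc⟩ := h
  let φ : ℕ → FlipData := fun i => F.getD i (s(0, 0), s(0, 0))
  have hφ : ∀ i (hi : i < F.length), φ i = F[i] := fun i hi => by simp [φ, hi]
  let τ : ℕ → ℕ := fun i => if hi : i < F.length then (σ.symm ⟨i, hi⟩ : ℕ) else 0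
  have hτ : ∀ i (hi : i < F.length), τ i = (σ.symm ⟨i, hi⟩ : ℕ) := fun i hi => dif_pos hi
  rw [hlen]
  refine (hF.validFlips hφ).of_topologicalSorting (τ := τ) (fun i hi => ?_)
    (fun i hi j hj hij => ?_) (fun i hi => ?_) (fun i j hj hij => ?_)
  · rw [hτ i hi]
    exact (σ.symm ⟨i, hi⟩).2
  · rw [hτ i hi, hτ j hj] at hij
    simpa using σ.symm.injective (Fin.ext hij)
  · rw [hφ i hi, hτ i hi, hψ _ (by rw [hlen]; exact (σ.symm ⟨i, hi⟩).2)]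
    have := hσ (σ.symm ⟨i, hi⟩)
    simp only [Equiv.apply_symm_apply] at this
    exact this.symm
  · have hi : i < F.length := hij.1.trans hj
    rw [hτ i hi, hτ j hj]
    refine harc _ _ ?_
    simpa using hij.arc hφ hj

/-- If `F` is a shortest valid sequence from `T_start` to `T_end` and
`F'` is a topological sorting of `D_F`, then no proper prefix of `F'` already
transforms `T_start` into `T_end`. -/
theorem proper_prefix_not_Tend
    (P : Set Pt) (hfin : P.Finite) (hncol : ¬ Collinear ℝ P)
    (Tstart Tend : Set (Sym2 Pt)) (F F' : List FlipData)
    (hF : ValidSeq P Tstart F Tend)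
    (hmin : ∀ F₂ : List FlipData, ValidSeq P Tstart F₂ Tend → F.length ≤ F₂.length)
    (htopo : IsTopologicalSorting P Tstart F F')
    (j : ℕ) (hj : j < F.length) :
    applyFlips Tstart (F'.take j) ≠ Tend := by
  intro hend
  obtain ⟨hlen, -⟩ := id htopo
  have hv := htopo.validFlips hF (ψ := fun i => F'.getD i (s(0, 0), s(0, 0)))
    fun i hi => by simp [hi]
  have hs := hv.validSeq_take (fun i hi => by simp [hi]) j
  rw [hend] at hs
  have := hmin _ hs
  rw [List.length_take] at this
  omega

end
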